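/- Product rule for Bowen pressure: Let (X,T) and (Y,R) be NDSs, Z ⊂ X_0, W ⊂ Y_0, and let f (on X) and g (on Y) be equicontinuous potentials. Then P^B(T,f,Z) + P^B(R,g,W) ≤ P^B(T×R, f∔g, Z×W) ≤ P^B(T,f,Z) + P^P(R,g,W), provided the sums appearing are not of the form (+∞)+(−∞). -/

import Mathlib

open Filter Set
open scoped ENNReal NNReal

noncomputable section

namespace NDS

variable {X : ℕ → Type*}

/-- The orbit maps `T_k^j : X k → X (k+j)` of a nonautonomous system. -/
def iterFrom (T : ∀ k, X k → X (k + 1)) (k : ℕ) : ∀ j, X k → X (k + j)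
  | 0 => fun x => x
  | j + 1 => fun x => T (k + j) (iterFrom T k j x)

/-- The orbit maps `T^j = T_{j-1} ∘ ⋯ ∘ T_0 : X 0 → X j`. -/
def iter (T : ∀ k, X k → X (k + 1)) : ∀ j, X 0 → X j
  | 0 => fun x => x
  | j + 1 => fun x => T j (iter T j x)

variable [∀ k, MetricSpace (X k)]

/-- The `n`-th Bowen metric on `X 0`:  `d_n^T(x,y) = max_{0 ≤ j ≤ n-1} d_j (T^j x) (T^j y)`. -/
def bowenDist (T : ∀ k, X k → X (k + 1)) (n : ℕ) (x y : X 0) : ℝ :=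
  (((Finset.range n).sup fun j => nndist (iter T j x) (iter T j y) : ℝ≥0) : ℝ)

/-- The open Bowen ball `B_n^T(x, ε)`. -/
def bowenBall (T : ∀ k, X k → X (k + 1)) (n : ℕ) (x : X 0) (ε : ℝ) : Set (X 0) :=
  {y | bowenDist T n x y < ε}

/-- The closed Bowen ball `clB_n^T(x, ε)`. -/
def bowenClosedBall (T : ∀ k, X k → X (k + 1)) (n : ℕ) (x : X 0) (ε : ℝ) : Set (X 0) :=
  {y | bowenDist T n x y ≤ ε}

/-- Birkhoff sums starting at level `k`:  `S_{k,n}^T f = Σ_{j<n} f_{k+j} ∘ T_k^j`. -/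
def birkFrom (T : ∀ k, X k → X (k + 1)) (f : ∀ k, X k → ℝ) (k n : ℕ) (x : X k) : ℝ :=
  ∑ j ∈ Finset.range n, f (k + j) (iterFrom T k j x)

/-- Birkhoff sums `S_n^T f = Σ_{j<n} f_j ∘ T^j` on `X 0`. -/
def birk (T : ∀ k, X k → X (k + 1)) (f : ∀ k, X k → ℝ) (n : ℕ) (x : X 0) : ℝ :=
  ∑ j ∈ Finset.range n, f j (iter T j x)

/-- A potential `f = {f_k}` is equicontinuous. -/
def EquicontPotential (f : ∀ k, X k → ℝ) : Prop :=
  ∀ ε : ℝ, 0 < ε → ∃ δ : ℝ, 0 < δ ∧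
    ∀ k, ∀ x y : X k, dist x y < δ → |f k x - f k y| < ε

/-- The sequence of maps `T = {T_k}` is equicontinuous. -/
def EquicontMaps (T : ∀ k, X k → X (k + 1)) : Prop :=
  ∀ ε : ℝ, 0 < ε → ∃ δ : ℝ, 0 < δ ∧
    ∀ k, ∀ x y : X k, dist x y < δ → dist (T k x) (T k y) < ε

/-- `F` is an `(n,ε)`-spanning set for `Z`. -/
def IsSpanning (T : ∀ k, X k → X (k + 1)) (n : ℕ) (ε : ℝ) (Z : Set (X 0))
    (F : Finset (X 0)) : Prop :=
  ∀ x ∈ Z, ∃ y ∈ F, bowenDist T n x y ≤ ε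

/-- `E` is an `(n,ε)`-separated set for `Z`. -/
def IsSeparated (T : ∀ k, X k → X (k + 1)) (n : ℕ) (ε : ℝ) (Z : Set (X 0))
    (E : Finset (X 0)) : Prop :=
  ↑E ⊆ Z ∧ ∀ x ∈ E, ∀ y ∈ E, x ≠ y → ε < bowenDist T n x y

/-- The partition sum `Σ_{x ∈ F} e^{S_n^T f(x)}` (valued in `ℝ≥0∞`). -/
def partSum (T : ∀ k, X k → X (k + 1)) (f : ∀ k, X k → ℝ) (n : ℕ) (F : Finset (X 0)) : ℝ≥0∞ :=
  ∑ x ∈ F, ENNReal.ofReal (Real.exp (birk T f n x))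

/-- `Q_n(T,f,Z,ε)`, infimum over `(n,ε)`-spanning sets. -/
def Qn (T : ∀ k, X k → X (k + 1)) (f : ∀ k, X k → ℝ) (Z : Set (X 0)) (n : ℕ) (ε : ℝ) : ℝ≥0∞ :=
  ⨅ (F : Finset (X 0)) (_ : IsSpanning T n ε Z F), partSum T f n F

/-- `P_n(T,f,Z,ε)`, supremum over `(n,ε)`-separated sets. -/
def Pn (T : ∀ k, X k → X (k + 1)) (f : ∀ k, X k → ℝ) (Z : Set (X 0)) (n : ℕ) (ε : ℝ) : ℝ≥0∞ :=
  ⨆ (E : Finset (X 0)) (_ : IsSeparated T n ε Z E), partSum T f n E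

/-- `liminf_n (1/n) log u n` (in `EReal`). -/
def lowRate (u : ℕ → ℝ≥0∞) : EReal :=
  Filter.atTop.liminf fun n : ℕ => (((n : ℝ)⁻¹ : ℝ) : EReal) * ENNReal.log (u n)

/-- `limsup_n (1/n) log u n` (in `EReal`). -/
def upRate (u : ℕ → ℝ≥0∞) : EReal :=
  Filter.atTop.limsup fun n : ℕ => (((n : ℝ)⁻¹ : ℝ) : EReal) * ENNReal.log (u n)

/-- Lower spanning topological pressure `Q_low(T,f,Z)`; the limit as `ε → 0` is realised as a
supremum over `ε > 0`, the quantity being monotone in `ε`. -/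
def Qlow (T : ∀ k, X k → X (k + 1)) (f : ∀ k, X k → ℝ) (Z : Set (X 0)) : EReal :=
  ⨆ (ε : ℝ) (_ : 0 < ε), lowRate fun n => Qn T f Z n ε

/-- Upper spanning topological pressure `Q_up(T,f,Z)`. -/
def Qup (T : ∀ k, X k → X (k + 1)) (f : ∀ k, X k → ℝ) (Z : Set (X 0)) : EReal :=
  ⨆ (ε : ℝ) (_ : 0 < ε), upRate fun n => Qn T f Z n ε

/-- Lower separated topological pressure `P_low(T,f,Z)`. -/
def Plow (T : ∀ k, X k → X (k + 1)) (f : ∀ k, X k → ℝ) (Z : Set (X 0)) : EReal :=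
  ⨆ (ε : ℝ) (_ : 0 < ε), lowRate fun n => Pn T f Z n ε

/-- Upper separated topological pressure `P_up(T,f,Z)`. -/
def Pup (T : ∀ k, X k → X (k + 1)) (f : ∀ k, X k → ℝ) (Z : Set (X 0)) : EReal :=
  ⨆ (ε : ℝ) (_ : 0 < ε), upRate fun n => Pn T f Z n ε

/-- The critical value `inf {s : M s = 0}` of a "measure profile" `M`, as an extended real. -/
def crit (M : ℝ → ℝ≥0∞) : EReal :=
  sInf (Real.toEReal '' {s : ℝ | M s = 0})

/-- The critical value `sup {s : M s = ∞}` of a "measure profile" `M`, as an extended real. -/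
def critSup (M : ℝ → ℝ≥0∞) : EReal :=
  sSup (Real.toEReal '' {s : ℝ | M s = ⊤})

/-- A countable family of Bowen balls (recorded by their (center, order) data) which is an
`(N,ε)`-cover of `Z`. -/
def IsBowenCover (T : ∀ k, X k → X (k + 1)) (N : ℕ) (ε : ℝ) (Z : Set (X 0))
    (C : Set (X 0 × ℕ)) : Prop :=
  C.Countable ∧ (∀ p ∈ C, N ≤ p.2) ∧ Z ⊆ ⋃ p ∈ C, bowenBall T p.2 p.1 ε

/-- A countable disjoint family of closed Bowen balls with centers in `Z` and orders `≥ N`: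
an `(N,ε)`-packing of `Z`. -/
def IsBowenPacking (T : ∀ k, X k → X (k + 1)) (N : ℕ) (ε : ℝ) (Z : Set (X 0))
    (P : Set (X 0 × ℕ)) : Prop :=
  P.Countable ∧ (∀ p ∈ P, p.1 ∈ Z ∧ N ≤ p.2) ∧
    ∀ p ∈ P, ∀ q ∈ P, p ≠ q →
      Disjoint (bowenClosedBall T p.2 p.1 ε) (bowenClosedBall T q.2 q.1 ε)

/-- `Σ_i exp (-n_i s + S_{n_i}^T f (x_i))` over a family of (center, order) pairs. -/
def ballSum (T : ∀ k, X k → X (k + 1)) (f : ∀ k, X k → ℝ) (s : ℝ) (C : Set (X 0 × ℕ)) : ℝ≥0∞ :=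
  ∑' p : C, ENNReal.ofReal (Real.exp (-(p.1.2 : ℝ) * s + birk T f p.1.2 p.1.1))

/-- The Hausdorff-type pre-measure `M^s_{N,ε}(T,f,Z)`. -/
def bowenPreMeas (T : ∀ k, X k → X (k + 1)) (f : ∀ k, X k → ℝ) (Z : Set (X 0))
    (s : ℝ) (N : ℕ) (ε : ℝ) : ℝ≥0∞ :=
  ⨅ (C : Set (X 0 × ℕ)) (_ : IsBowenCover T N ε Z C), ballSum T f s C

/-- `M^s_ε(T,f,Z) = lim_{N → ∞} M^s_{N,ε}(T,f,Z)` (an increasing limit, i.e. a supremum). -/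
def bowenMeas (T : ∀ k, X k → X (k + 1)) (f : ∀ k, X k → ℝ) (Z : Set (X 0))
    (s : ℝ) (ε : ℝ) : ℝ≥0∞ :=
  ⨆ N : ℕ, bowenPreMeas T f Z s N ε

/-- `P^B(T,f,Z,ε)`: the critical value of `s ↦ M^s_ε(T,f,Z)`. -/
def PBe (T : ∀ k, X k → X (k + 1)) (f : ∀ k, X k → ℝ) (Z : Set (X 0)) (ε : ℝ) : EReal :=
  crit fun s => bowenMeas T f Z s ε

/-- The Bowen (Pesin–Pitskel') topological pressure `P^B(T,f,Z)`; the limit as `ε → 0` is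
realised as a supremum over `ε > 0` by monotonicity. -/
def PB (T : ∀ k, X k → X (k + 1)) (f : ∀ k, X k → ℝ) (Z : Set (X 0)) : EReal :=
  ⨆ (ε : ℝ) (_ : 0 < ε), PBe T f Z ε

/-- The packing pre-measure `𝒫^s_{N,ε}(T,f,Z)`. -/
def packPre (T : ∀ k, X k → X (k + 1)) (f : ∀ k, X k → ℝ) (Z : Set (X 0))
    (s : ℝ) (N : ℕ) (ε : ℝ) : ℝ≥0∞ :=
  ⨆ (P : Set (X 0 × ℕ)) (_ : IsBowenPacking T N ε Z P), ballSum T f s P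

/-- The packing content `𝒫^s_{∞,ε}(T,f,Z) = lim_{N→∞} 𝒫^s_{N,ε}` (a decreasing limit, i.e. an
infimum). -/
def packContent (T : ∀ k, X k → X (k + 1)) (f : ∀ k, X k → ℝ) (Z : Set (X 0))
    (s : ℝ) (ε : ℝ) : ℝ≥0∞ :=
  ⨅ N : ℕ, packPre T f Z s N ε

/-- The packing measure `𝒫^s_ε(T,f,Z)`, obtained from the content by countable decompositions. -/
def packMeas (T : ∀ k, X k → X (k + 1)) (f : ∀ k, X k → ℝ) (Z : Set (X 0))
    (s : ℝ) (ε : ℝ) : ℝ≥0∞ :=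
  ⨅ (D : ℕ → Set (X 0)) (_ : Z ⊆ ⋃ i, D i), ∑' i, packContent T f (D i) s ε

/-- `P^P(T,f,Z,ε)`: the critical value of `s ↦ 𝒫^s_ε(T,f,Z)`. -/
def PPe (T : ∀ k, X k → X (k + 1)) (f : ∀ k, X k → ℝ) (Z : Set (X 0)) (ε : ℝ) : EReal :=
  crit fun s => packMeas T f Z s ε

/-- The packing topological pressure `P^P(T,f,Z)`. -/
def PP (T : ∀ k, X k → X (k + 1)) (f : ∀ k, X k → ℝ) (Z : Set (X 0)) : EReal :=
  ⨆ (ε : ℝ) (_ : 0 < ε), PPe T f Z ε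

end NDS

/-- The sum `a + b` in `EReal` is not of the indeterminate form `(+∞) + (−∞)`. -/
def NDS.AddCompat (a b : EReal) : Prop :=
  ¬(a = ⊤ ∧ b = ⊥) ∧ ¬(a = ⊥ ∧ b = ⊤)

namespace NDS

section helpers

variable {X : ℕ → Type*} [∀ k, MetricSpace (X k)] {Y : ℕ → Type*} [∀ k, MetricSpace (Y k)]

lemma bowenDist_lt_iff (T : ∀ k, X k → X (k + 1)) (n : ℕ) (x y : X 0) {ε : ℝ} (hε : 0 < ε) :
    bowenDist T n x y < ε ↔ ∀ j < n, dist (iter T j x) (iter T j y) < ε := by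
  lift ε to ℝ≥0 using hε.le
  unfold bowenDist
  rw [NNReal.coe_lt_coe, Finset.sup_lt_iff (by simpa using hε)]
  simp only [Finset.mem_range, ← NNReal.coe_lt_coe, coe_nndist]

lemma bowenDist_le_iff (T : ∀ k, X k → X (k + 1)) (n : ℕ) (x y : X 0) {ε : ℝ} (hε : 0 ≤ ε) :
    bowenDist T n x y ≤ ε ↔ ∀ j < n, dist (iter T j x) (iter T j y) ≤ ε := by
  lift ε to ℝ≥0 using hε
  unfold bowenDist
  rw [NNReal.coe_le_coe, Finset.sup_le_iff]
  simp only [Finset.mem_range, ← NNReal.coe_le_coe, coe_nndist]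

lemma bowenDist_nonneg (T : ∀ k, X k → X (k + 1)) (n : ℕ) (x y : X 0) :
    0 ≤ bowenDist T n x y := NNReal.coe_nonneg _

lemma bowenDist_comm (T : ∀ k, X k → X (k + 1)) (n : ℕ) (x y : X 0) :
    bowenDist T n x y = bowenDist T n y x := by
  unfold bowenDist
  simp only [nndist_comm]

lemma bowenDist_self (T : ∀ k, X k → X (k + 1)) (n : ℕ) (x : X 0) :
    bowenDist T n x x = 0 :=
  le_antisymm ((bowenDist_le_iff T n x x le_rfl).2 (by simp)) (bowenDist_nonneg T n x x)

lemma bowenDist_triangle (T : ∀ k, X k → X (k + 1)) (n : ℕ) (x y z : X 0) :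
    bowenDist T n x z ≤ bowenDist T n x y + bowenDist T n y z := by
  rw [bowenDist_le_iff T n x z (add_nonneg (bowenDist_nonneg _ _ _ _) (bowenDist_nonneg _ _ _ _))]
  intro j hj
  have h1 := (bowenDist_le_iff T n x y (bowenDist_nonneg _ _ _ _)).1 le_rfl j hj
  have h2 := (bowenDist_le_iff T n y z (bowenDist_nonneg _ _ _ _)).1 le_rfl j hj
  exact (dist_triangle _ (iter T j y) _).trans (add_le_add h1 h2)

/-- The weight of a ball. -/
def wt (T : ∀ k, X k → X (k + 1)) (f : ∀ k, X k → ℝ) (s : ℝ) (p : X 0 × ℕ) : ℝ≥0∞ :=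
  ENNReal.ofReal (Real.exp (-(p.2 : ℝ) * s + birk T f p.2 p.1))

lemma ballSum_eq (T : ∀ k, X k → X (k + 1)) (f : ∀ k, X k → ℝ) (s : ℝ) (C : Set (X 0 × ℕ)) :
    ballSum T f s C = ∑' p : C, wt T f s p := rfl

lemma wt_pos (T : ∀ k, X k → X (k + 1)) (f : ∀ k, X k → ℝ) (s : ℝ) (p : X 0 × ℕ) :
    wt T f s p ≠ 0 := by
  simp [wt, Real.exp_pos]

lemma wt_anti (T : ∀ k, X k → X (k + 1)) (f : ∀ k, X k → ℝ) {s s' : ℝ} (h : s ≤ s')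
    (p : X 0 × ℕ) : wt T f s' p ≤ wt T f s p := by
  apply ENNReal.ofReal_le_ofReal
  apply Real.exp_le_exp.2
  have : (p.2 : ℝ) * s ≤ p.2 * s' := mul_le_mul_of_nonneg_left h (Nat.cast_nonneg _)
  linarith

lemma ballSum_anti (T : ∀ k, X k → X (k + 1)) (f : ∀ k, X k → ℝ) {s s' : ℝ} (h : s ≤ s')
    (C : Set (X 0 × ℕ)) : ballSum T f s' C ≤ ballSum T f s C :=
  ENNReal.tsum_le_tsum fun p => wt_anti T f h p.1

lemma bowenPreMeas_mono (T : ∀ k, X k → X (k + 1)) (f : ∀ k, X k → ℝ) (Z : Set (X 0))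
    {s s' : ℝ} (h : s ≤ s') {N N' : ℕ} (hN : N' ≤ N) {ε ε' : ℝ} (hε : ε ≤ ε') :
    bowenPreMeas T f Z s' N' ε' ≤ bowenPreMeas T f Z s N ε := by
  refine le_iInf₂ fun C hC => (iInf₂_le C ?_).trans (ballSum_anti T f h C)
  refine ⟨hC.1, fun p hp => hN.trans (hC.2.1 p hp), hC.2.2.trans ?_⟩
  exact iUnion₂_mono fun p _ y hy => lt_of_lt_of_le hy hε

lemma bowenMeas_mono (T : ∀ k, X k → X (k + 1)) (f : ∀ k, X k → ℝ) (Z : Set (X 0))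
    {s s' : ℝ} (h : s ≤ s') {ε ε' : ℝ} (hε : ε ≤ ε') :
    bowenMeas T f Z s' ε' ≤ bowenMeas T f Z s ε :=
  iSup_mono fun _ => bowenPreMeas_mono T f Z h le_rfl hε

lemma packMeas_anti (T : ∀ k, X k → X (k + 1)) (f : ∀ k, X k → ℝ) (Z : Set (X 0))
    {s s' : ℝ} (h : s ≤ s') (ε : ℝ) :
    packMeas T f Z s' ε ≤ packMeas T f Z s ε :=
  iInf₂_mono fun _ _ => ENNReal.tsum_le_tsum fun _ => iInf_mono fun _ =>
    iSup₂_mono fun P _ => ballSum_anti T f h P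

lemma eq_zero_of_crit_lt {M : ℝ → ℝ≥0∞} (hM : Antitone M) {s : ℝ} (h : crit M < s) :
    M s = 0 := by
  obtain ⟨_, ⟨r, hr, rfl⟩, hrs⟩ := sInf_lt_iff.1 h
  have := hM (EReal.coe_lt_coe_iff.1 hrs).le
  rw [show M r = 0 from hr] at this
  simpa using this

lemma crit_le {M : ℝ → ℝ≥0∞} {s : ℝ} (h : M s = 0) : crit M ≤ s :=
  sInf_le ⟨s, h, rfl⟩

lemma ne_zero_of_lt_crit {M : ℝ → ℝ≥0∞} {s : ℝ} (h : (s : EReal) < crit M) : M s ≠ 0 :=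
  fun h0 => absurd (crit_le h0) (not_le.2 h)

lemma le_crit {M : ℝ → ℝ≥0∞} (hM : Antitone M) {s : ℝ} (h : M s ≠ 0) : (s : EReal) ≤ crit M := by
  by_contra hc
  exact h (eq_zero_of_crit_lt hM (not_le.1 hc))

/-- Maximal pairwise-`r` subsets exist. -/
lemma exists_max_pairwise {α : Type*} (D : Set α) (r : α → α → Prop)
    (hr : ∀ x y, r x y → r y x) :
    ∃ F ⊆ D, F.Pairwise r ∧ ∀ y ∈ D, y ∈ F ∨ ∃ y' ∈ F, ¬ r y' y := by
  obtain ⟨F, hF⟩ := zorn_subset {F : Set α | F ⊆ D ∧ F.Pairwise r} (by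
    intro c hc hch
    refine ⟨⋃₀ c, ⟨sUnion_subset fun t ht => (hc ht).1, ?_⟩, fun s hs => subset_sUnion_of_mem hs⟩
    rw [Set.pairwise_sUnion hch.directedOn]
    exact fun t ht => (hc ht).2)
  refine ⟨F, hF.prop.1, hF.prop.2, fun y hy => ?_⟩
  by_contra! hcon
  have hin : insert y F ∈ {F : Set α | F ⊆ D ∧ F.Pairwise r} := by
    refine ⟨insert_subset hy hF.prop.1, hF.prop.2.insert fun b hb _ => ?_⟩
    exact ⟨hr _ _ (hcon.2 b hb), hcon.2 b hb⟩
  exact hcon.1 (hF.le_of_ge hin (subset_insert y F) (mem_insert y F))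

lemma tsum_ite_le_of_unique {α : Type*} (p : α → Prop) [DecidablePred p] (a : ℝ≥0∞)
    (h : ∀ x y, p x → p y → x = y) : ∑' x, (if p x then a else 0) ≤ a := by
  by_cases hx : ∃ x, p x
  · obtain ⟨x, hx⟩ := hx
    rw [tsum_eq_single x]
    · simp [hx]
    · intro y hy
      rw [if_neg]
      exact fun hpy => hy (h _ _ hpy hx)
  · push Not at hx
    simp [hx]

/-- Null sets are stable under countable unions. -/
lemma bowenPreMeas_iUnion_zero (T : ∀ k, X k → X (k + 1)) (f : ∀ k, X k → ℝ) (Z : Set (X 0))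
    (A : ℕ → Set (X 0)) (hZ : Z ⊆ ⋃ i, A i) (s : ℝ) (N : ℕ) (ε : ℝ)
    (h : ∀ i, bowenPreMeas T f (A i) s N ε = 0) : bowenPreMeas T f Z s N ε = 0 := by
  by_contra hne
  obtain ⟨η, hη, hsum⟩ := ENNReal.exists_pos_sum_of_countable hne ℕ
  have : ∀ i, ∃ C, IsBowenCover T N ε (A i) C ∧ ballSum T f s C < η i := by
    intro i
    have hi : bowenPreMeas T f (A i) s N ε < η i := by rw [h i]; exact_mod_cast hη i
    unfold bowenPreMeas at hi
    simpa only [iInf_lt_iff, exists_prop] using hi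
  choose C hC hCs using this
  refine absurd ?_ (not_le.2 hsum)
  have hcov : IsBowenCover T N ε Z (⋃ i, C i) := by
    refine ⟨countable_iUnion fun i => (hC i).1, ?_, ?_⟩
    · intro p hp
      obtain ⟨i, hi⟩ := mem_iUnion.1 hp
      exact (hC i).2.1 p hi
    · intro z hz
      obtain ⟨i, hi⟩ := mem_iUnion.1 (hZ hz)
      obtain ⟨p, hp, hzp⟩ := mem_iUnion₂.1 ((hC i).2.2 hi)
      exact mem_iUnion₂.2 ⟨p, mem_iUnion.2 ⟨i, hp⟩, hzp⟩
  calc bowenPreMeas T f Z s N ε ≤ ballSum T f s (⋃ i, C i) := iInf₂_le _ hcov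
    _ ≤ ∑' i, ballSum T f s (C i) := ENNReal.tsum_iUnion_le_tsum (wt T f s) C
    _ ≤ ∑' i, (η i : ℝ≥0∞) := ENNReal.tsum_le_tsum fun i => (hCs i).le

/-- Product maps. -/
abbrev pm (T : ∀ k, X k → X (k + 1)) (R : ∀ k, Y k → Y (k + 1)) :
    ∀ k, (fun k => X k × Y k) k → (fun k => X k × Y k) (k + 1) :=
  fun k p => (T k p.1, R k p.2)

/-- Product potentials. -/
abbrev pf (f : ∀ k, X k → ℝ) (g : ∀ k, Y k → ℝ) : ∀ k, (fun k => X k × Y k) k → ℝ :=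
  fun k p => f k p.1 + g k p.2

lemma iter_prod (T : ∀ k, X k → X (k + 1)) (R : ∀ k, Y k → Y (k + 1)) (j : ℕ)
    (p : X 0 × Y 0) :
    iter (X := fun k => X k × Y k) (pm T R) j p = (iter T j p.1, iter R j p.2) := by
  induction j with
  | zero => rfl
  | succ j ih => simp only [iter, ih]

lemma birk_prod (T : ∀ k, X k → X (k + 1)) (R : ∀ k, Y k → Y (k + 1))
    (f : ∀ k, X k → ℝ) (g : ∀ k, Y k → ℝ) (n : ℕ) (p : X 0 × Y 0) :
    birk (X := fun k => X k × Y k) (pm T R) (pf f g) n p = birk T f n p.1 + birk R g n p.2 := by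
  simp only [birk, iter_prod, Finset.sum_add_distrib]

lemma wt_prod (T : ∀ k, X k → X (k + 1)) (R : ∀ k, Y k → Y (k + 1))
    (f : ∀ k, X k → ℝ) (g : ∀ k, Y k → ℝ) (s t : ℝ) (x : X 0) (y : Y 0) (n : ℕ) :
    wt (X := fun k => X k × Y k) (pm T R) (pf f g) (s + t) ((x, y), n)
      = wt T f s (x, n) * wt R g t (y, n) := by
  unfold wt
  rw [← ENNReal.ofReal_mul (Real.exp_pos _).le, ← Real.exp_add, birk_prod]
  congr 2
  ring

lemma bowenDist_prod_lt (T : ∀ k, X k → X (k + 1)) (R : ∀ k, Y k → Y (k + 1)) (n : ℕ)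
    (p q : X 0 × Y 0) {ε : ℝ} (hε : 0 < ε) :
    bowenDist (X := fun k => X k × Y k) (pm T R) n p q < ε ↔
      bowenDist T n p.1 q.1 < ε ∧ bowenDist R n p.2 q.2 < ε := by
  rw [bowenDist_lt_iff _ _ _ _ hε, bowenDist_lt_iff _ _ _ _ hε, bowenDist_lt_iff _ _ _ _ hε]
  simp only [iter_prod, Prod.dist_eq, max_lt_iff]
  exact ⟨fun h => ⟨fun j hj => (h j hj).1, fun j hj => (h j hj).2⟩,
    fun h j hj => ⟨h.1 j hj, h.2 j hj⟩⟩

/-- From a bounded packing content one gets efficient spanning sets at every level. -/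
lemma exists_spanning_of_packPre (R : ∀ k, Y k → Y (k + 1)) (g : ∀ k, Y k → ℝ) (D : Set (Y 0))
    (t : ℝ) (N₀ : ℕ) {ε₁ ε : ℝ} (h₁ : 0 < ε₁) (h₂ : 2 * ε₁ < ε)
    (hP : packPre R g D t N₀ ε₁ ≤ 1) (n : ℕ) (hn : N₀ ≤ n) :
    ∃ F : Set (Y 0), F.Countable ∧ (∑' y : F, wt R g t (y.1, n)) ≤ 1 ∧
      ∀ y ∈ D, ∃ y' ∈ F, bowenDist R n y' y < ε := by
  obtain ⟨F, hFD, hFp, hFm⟩ := exists_max_pairwise D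
    (fun x y => Disjoint (bowenClosedBall R n x ε₁) (bowenClosedBall R n y ε₁))
    (fun x y h => h.symm)
  have key : ∀ G ⊆ F, G.Countable → (∑' y : G, wt R g t (y.1, n)) ≤ 1 := by
    intro G hG hGc
    have hpk : IsBowenPacking R N₀ ε₁ D ((fun y => (y, n)) '' G) := by
      refine ⟨hGc.image _, ?_, ?_⟩
      · rintro _ ⟨y, hy, rfl⟩
        exact ⟨hFD (hG hy), hn⟩
      · rintro _ ⟨y, hy, rfl⟩ _ ⟨y', hy', rfl⟩ hne
        exact hFp (hG hy) (hG hy') (fun h => hne (by rw [h]))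
    have hle : ballSum R g t ((fun y => (y, n)) '' G) ≤ packPre R g D t N₀ ε₁ :=
      le_iSup₂ (f := fun P (_ : IsBowenPacking R N₀ ε₁ D P) => ballSum R g t P) _ hpk
    rw [ballSum_eq, tsum_image (wt R g t) (fun a _ b _ h => (Prod.mk.inj h).1)] at hle
    exact hle.trans hP
  have hsum : (∑' y : F, wt R g t (y.1, n)) ≤ 1 := by
    rw [ENNReal.tsum_eq_iSup_sum]
    refine iSup_le fun S => ?_
    have h := key ((fun y : F => y.1) '' (S : Set F)) (by rintro _ ⟨y, _, rfl⟩; exact y.2)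
      (S.countable_toSet.image _)
    rw [tsum_image (fun y => wt R g t (y, n)) (Subtype.val_injective.injOn)] at h
    rwa [Finset.tsum_subtype' S (fun y : F => wt R g t (y.1, n))] at h
  refine ⟨F, ?_, hsum, ?_⟩
  · have hc := Summable.countable_support_ennreal (ne_top_of_le_ne_top ENNReal.one_ne_top hsum)
    have hu : Function.support (fun y : F => wt R g t (y.1, n)) = univ := by
      ext y; simp [wt_pos]
    rw [hu, Set.countable_univ_iff] at hc
    exact hc
  · intro y hy
    rcases hFm y hy with h | ⟨y', hy', h⟩
    · exact ⟨y, h, by rw [bowenDist_self]; linarith⟩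
    · refine ⟨y', hy', ?_⟩
      obtain ⟨z, hz, hz'⟩ := Set.not_disjoint_iff.1 h
      have h3 := bowenDist_triangle R n y' z y
      rw [bowenDist_comm R n z y] at h3
      have h4 : bowenDist R n y' z ≤ ε₁ := hz
      have h5 : bowenDist R n y z ≤ ε₁ := hz'
      linarith

lemma bowenPreMeas_prod_le (T : ∀ k, X k → X (k + 1)) (R : ∀ k, Y k → Y (k + 1))
    (f : ∀ k, X k → ℝ) (g : ∀ k, Y k → ℝ) (Z : Set (X 0)) (D : Set (Y 0))
    (s t : ℝ) (N₀ N : ℕ) (hN : N₀ ≤ N) {ε₁ ε : ℝ} (h₁ : 0 < ε₁) (h₂ : 2 * ε₁ < ε)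
    (hP : packPre R g D t N₀ ε₁ ≤ 1) :
    bowenPreMeas (X := fun k => X k × Y k) (pm T R) (pf f g) (Z ×ˢ D) (s + t) N ε
      ≤ bowenPreMeas T f Z s N ε := by
  refine le_iInf₂ fun C hC => ?_
  have hε : 0 < ε := by linarith
  have hsp := exists_spanning_of_packPre R g D t N₀ h₁ h₂ hP
  choose! F hFc hFs hFm using hsp
  let C' : Set ((X 0 × Y 0) × ℕ) :=
    ⋃ p ∈ C, (fun y => ((p.1, y), p.2)) '' F p.2
  have hcov : IsBowenCover (X := fun k => X k × Y k) (pm T R) N ε (Z ×ˢ D) C' := by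
    refine ⟨hC.1.biUnion fun p hp => (hFc p.2 (hN.trans (hC.2.1 p hp))).image _, ?_, ?_⟩
    · intro q hq
      obtain ⟨p, hp, y, hy, rfl⟩ := mem_iUnion₂.1 hq
      exact hC.2.1 p hp
    · rintro ⟨z, w⟩ ⟨hz, hw⟩
      obtain ⟨p, hp, hzp⟩ := mem_iUnion₂.1 (hC.2.2 hz)
      obtain ⟨y, hy, hyw⟩ := hFm p.2 (hN.trans (hC.2.1 p hp)) w hw
      refine mem_iUnion₂.2 ⟨((p.1, y), p.2), mem_iUnion₂.2 ⟨p, hp, y, hy, rfl⟩, ?_⟩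
      exact (bowenDist_prod_lt T R p.2 (p.1, y) (z, w) hε).2 ⟨hzp, hyw⟩
  refine (iInf₂_le C' hcov).trans ?_
  calc ballSum (X := fun k => X k × Y k) (pm T R) (pf f g) (s + t) C'
      ≤ ∑' p : C, ∑' q : ((fun y => ((p.1.1, y), p.1.2)) '' F p.1.2 : Set ((X 0 × Y 0) × ℕ)),
          wt (X := fun k => X k × Y k) (pm T R) (pf f g) (s + t) q :=
        ENNReal.tsum_biUnion_le_tsum _ C (fun p => (fun y => ((p.1, y), p.2)) '' F p.2)
    _ ≤ ∑' p : C, wt T f s p := by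
        refine ENNReal.tsum_le_tsum fun p => ?_
        rw [tsum_image (wt (X := fun k => X k × Y k) (pm T R) (pf f g) (s + t))
          (fun a _ b _ h => (Prod.mk.inj (Prod.mk.inj h).1).2)]
        simp only [wt_prod]
        rw [ENNReal.tsum_mul_left]
        calc _ ≤ wt T f s p.1 * 1 := by
              gcongr
              exact hFs p.1.2 (hN.trans (hC.2.1 p.1 p.2))
          _ = _ := mul_one _

lemma upper_bound (T : ∀ k, X k → X (k + 1)) (R : ∀ k, Y k → Y (k + 1))
    (f : ∀ k, X k → ℝ) (g : ∀ k, Y k → ℝ) (Z : Set (X 0)) (W : Set (Y 0))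
    (s t : ℝ) (hs : PB T f Z < s) (ht : PP R g W < t) :
    PB (X := fun k => X k × Y k) (pm T R) (pf f g) (Z ×ˢ W) ≤ ((s + t : ℝ) : EReal) := by
  refine iSup₂_le fun ε hε => crit_le ?_
  have hZ : bowenMeas T f Z s ε = 0 := by
    refine eq_zero_of_crit_lt (M := fun s => bowenMeas T f Z s ε)
      (fun a b h => bowenMeas_mono T f Z h le_rfl) (lt_of_le_of_lt ?_ hs)
    exact le_iSup₂ (f := fun ε (_ : 0 < ε) => PBe T f Z ε) ε hε
  have hW : packMeas R g W t (ε / 3) = 0 := by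
    refine eq_zero_of_crit_lt (M := fun s => packMeas R g W s (ε / 3))
      (fun a b h => packMeas_anti R g W h _) (lt_of_le_of_lt ?_ ht)
    exact le_iSup₂ (f := fun ε (_ : 0 < ε) => PPe R g W ε) (ε / 3) (by positivity)
  have hW1 : packMeas R g W t (ε / 3) < 1 := by rw [hW]; exact one_pos
  unfold packMeas at hW1
  simp only [iInf_lt_iff, exists_prop] at hW1
  obtain ⟨D, hD, hDs⟩ := hW1
  refine le_antisymm (iSup_le fun N => ?_) zero_le
  rw [nonpos_iff_eq_zero]
  refine bowenPreMeas_iUnion_zero (X := fun k => X k × Y k) (pm T R) (pf f g) (Z ×ˢ W)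
    (fun i => Z ×ˢ D i) ?_ (s + t) N ε fun i => ?_
  · rintro ⟨z, w⟩ ⟨hz, hw⟩
    obtain ⟨i, hi⟩ := mem_iUnion.1 (hD hw)
    exact mem_iUnion.2 ⟨i, hz, hi⟩
  · have hi : packContent R g (D i) t (ε / 3) < 1 := (ENNReal.le_tsum i).trans_lt hDs
    unfold packContent at hi
    obtain ⟨N₀, hN₀⟩ := iInf_lt_iff.1 hi
    rw [← nonpos_iff_eq_zero]
    calc _ ≤ bowenPreMeas (X := fun k => X k × Y k) (pm T R) (pf f g) (Z ×ˢ D i) (s + t)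
            (max N₀ N) ε := bowenPreMeas_mono _ _ _ le_rfl (le_max_right _ _) le_rfl
      _ ≤ bowenPreMeas T f Z s (max N₀ N) ε :=
          bowenPreMeas_prod_le T R f g Z (D i) s t N₀ _ (le_max_left _ _) (by positivity)
            (by linarith) hN₀.le
      _ ≤ bowenMeas T f Z s ε := le_iSup (fun N => bowenPreMeas T f Z s N ε) _
      _ = 0 := hZ

/-- Weighted covers are no better than covers. -/
lemma weighted (T : ∀ k, X k → X (k + 1)) (f : ∀ k, X k → ℝ) (Z : Set (X 0)) (s δ ε : ℝ)
    (hε : 0 < ε) (N : ℕ)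
    (hvar : ∀ n x y, bowenDist T n x y < ε → birk T f n y ≤ birk T f n x + n * δ)
    (hN : (∑' n : ℕ, if N ≤ n then ENNReal.ofReal (Real.exp (-(n * δ))) else 0) < 1)
    {ι : Type*} [Countable ι] (x : ι → X 0) (m : ι → ℕ) (c : ι → ℝ≥0∞) (hm : ∀ i, N ≤ m i)
    (hc : ∀ z ∈ Z, 1 ≤ ∑' i, (open Classical in if bowenDist T (m i) (x i) z < ε then c i else 0)) :
    bowenPreMeas T f Z (s + 2 * δ) N (2 * ε) ≤ ∑' i, c i * wt T f s (x i, m i) := by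
  classical
  let A : ℕ → X 0 → ℝ≥0∞ := fun n z =>
    ∑' i, if m i = n ∧ bowenDist T (m i) (x i) z < ε then c i else 0
  let u : ℕ → ℝ≥0∞ := fun n => ENNReal.ofReal (Real.exp (-(n * δ)))
  have hA : ∀ z ∈ Z, ∃ n, N ≤ n ∧ u n < A n z := by
    intro z hz
    by_contra! hcon
    refine absurd (hc z hz) (not_le.2 (lt_of_le_of_lt ?_ hN))
    calc _ = ∑' i, ∑' n, (if m i = n ∧ bowenDist T (m i) (x i) z < ε then c i else 0) := by
            refine tsum_congr fun i => ?_
            rw [tsum_eq_single (m i)]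
            · simp
            · intro n hn
              rw [if_neg]
              exact fun h => hn h.1.symm
      _ = ∑' n, A n z := ENNReal.tsum_comm
      _ ≤ _ := by
            refine ENNReal.tsum_le_tsum fun n => ?_
            split_ifs with h
            · exact hcon n h
            · rw [nonpos_iff_eq_zero, ENNReal.tsum_eq_zero]
              intro i
              rw [if_neg]
              rintro ⟨rfl, _⟩
              exact h (hm i)
  have hE := fun n => exists_max_pairwise {z | N ≤ n ∧ z ∈ Z ∧ u n < A n z}
    (fun z z' => 2 * ε ≤ bowenDist T n z z') (fun z z' h => by rwa [bowenDist_comm])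
  choose E hEs hEp hEm using hE
  let C : Set (X 0 × ℕ) := {q | q.1 ∈ E q.2}
  have huniq : ∀ i, ∀ q q' : C, (m i = q.1.2 ∧ bowenDist T (m i) (x i) q.1.1 < ε) →
      (m i = q'.1.2 ∧ bowenDist T (m i) (x i) q'.1.1 < ε) → q = q' := by
    rintro i ⟨⟨z, n⟩, hq⟩ ⟨⟨z', n'⟩, hq'⟩ ⟨h1, h2⟩ ⟨h3, h4⟩
    simp only at h1 h2 h3 h4
    subst h1
    subst h3
    have : z = z' := by
      by_contra hne
      have h5 : 2 * ε ≤ bowenDist T (m i) z z' := hEp (m i) hq hq' hne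
      have h6 := bowenDist_triangle T (m i) z (x i) z'
      rw [bowenDist_comm T (m i) z (x i)] at h6
      linarith
    subst this
    rfl
  have hex : ∀ q : C, ∃ i, m i = q.1.2 ∧ bowenDist T (m i) (x i) q.1.1 < ε := by
    intro q
    by_contra! hcon
    have h1 : u q.1.2 < A q.1.2 q.1.1 := (hEs q.1.2 q.2).2.2
    have h2 : A q.1.2 q.1.1 = 0 := by
      rw [ENNReal.tsum_eq_zero]
      intro i
      rw [if_neg]
      exact fun h => absurd h.2 (not_lt.2 (hcon i h.1))
    rw [h2] at h1
    exact absurd h1 not_lt_zero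
  have hCc : C.Countable := by
    choose φ hφ using hex
    have : Function.Injective φ := fun q q' h => huniq (φ q) q q' (hφ q) (h ▸ hφ q')
    exact this.countable
  have hcov : IsBowenCover T N (2 * ε) Z C := by
    refine ⟨hCc, fun q hq => (hEs q.2 hq).1, fun z hz => ?_⟩
    obtain ⟨n, hn, hnz⟩ := hA z hz
    rcases hEm n z ⟨hn, hz, hnz⟩ with h | ⟨z', hz', h⟩
    · refine mem_iUnion₂.2 ⟨(z, n), h, ?_⟩
      change bowenDist T n z z < 2 * ε
      rw [bowenDist_self]
      linarith
    · exact mem_iUnion₂.2 ⟨(z', n), hz', not_le.1 h⟩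
  refine (iInf₂_le C hcov).trans ?_
  calc ballSum T f (s + 2 * δ) C
      ≤ ∑' q : C, ∑' i, (if m i = q.1.2 ∧ bowenDist T (m i) (x i) q.1.1 < ε
          then c i * wt T f s (x i, m i) else 0) := by
        refine ENNReal.tsum_le_tsum fun q => ?_
        obtain ⟨⟨z, n⟩, hq⟩ := q
        have h1 : u n ≤ A n z := (hEs n hq).2.2.le
        let v : ℝ≥0∞ := ENNReal.ofReal (Real.exp (n * δ)) * wt T f (s + 2 * δ) (z, n)
        have h3 : wt T f (s + 2 * δ) (z, n) = u n * v := by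
          simp only [u, v, wt]
          rw [← ENNReal.ofReal_mul (Real.exp_pos _).le, ← ENNReal.ofReal_mul (Real.exp_pos _).le,
            ← Real.exp_add, ← Real.exp_add]
          congr 2
          ring
        calc wt T f (s + 2 * δ) (z, n) = u n * v := h3
          _ ≤ A n z * v := by gcongr
          _ = ∑' i, (if m i = n ∧ bowenDist T (m i) (x i) z < ε then c i else 0) * v :=
              ENNReal.tsum_mul_right.symm
          _ ≤ _ := by
              refine ENNReal.tsum_le_tsum fun i => ?_
              dsimp only
              split_ifs with h
              · obtain ⟨rfl, h⟩ := h
                gcongr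
                simp only [v, wt]
                rw [← ENNReal.ofReal_mul (Real.exp_pos _).le, ← Real.exp_add]
                apply ENNReal.ofReal_le_ofReal
                apply Real.exp_le_exp.2
                have := hvar (m i) (x i) z h
                linarith
              · simp
    _ = ∑' i, ∑' q : C, (if m i = q.1.2 ∧ bowenDist T (m i) (x i) q.1.1 < ε
          then c i * wt T f s (x i, m i) else 0) := ENNReal.tsum_comm
    _ ≤ ∑' i, c i * wt T f s (x i, m i) :=
        ENNReal.tsum_le_tsum fun i => tsum_ite_le_of_unique _ _ (huniq i)

lemma le_bowenPreMeas_prod (T : ∀ k, X k → X (k + 1)) (R : ∀ k, Y k → Y (k + 1))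
    (f : ∀ k, X k → ℝ) (g : ∀ k, Y k → ℝ) (Z : Set (X 0)) (W : Set (Y 0))
    (s t δ ε : ℝ) (hε : 0 < ε) (N : ℕ)
    (hvar : ∀ n x y, bowenDist T n x y < ε → birk T f n y ≤ birk T f n x + n * δ)
    (hN : (∑' n : ℕ, if N ≤ n then ENNReal.ofReal (Real.exp (-(n * δ))) else 0) < 1)
    (a : ℝ≥0∞) (ha0 : a ≠ 0) (hat : a ≠ ⊤) (ha : a ≤ bowenPreMeas R g W t N ε) :
    a * bowenPreMeas T f Z (s + 2 * δ) N (2 * ε) ≤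
      bowenPreMeas (X := fun k => X k × Y k) (pm T R) (pf f g) (Z ×ˢ W) (s + t) N ε := by
  classical
  refine le_iInf₂ fun C hC => ?_
  have : Countable C := hC.1
  have hw := weighted T f Z s δ ε hε N hvar hN (ι := C) (fun i => i.1.1.1) (fun i => i.1.2)
    (fun i => a⁻¹ * wt R g t (i.1.1.2, i.1.2)) (fun i => hC.2.1 i.1 i.2) (by
      intro z hz
      let G : Set (Y 0 × ℕ) :=
        (fun q : (X 0 × Y 0) × ℕ => (q.1.2, q.2)) '' {q | q ∈ C ∧ bowenDist T q.2 q.1.1 z < ε}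
      have hG : IsBowenCover R N ε W G := by
        refine ⟨(hC.1.mono fun q hq => hq.1).image _, ?_, ?_⟩
        · rintro _ ⟨q, hq, rfl⟩
          exact hC.2.1 q hq.1
        · intro w hw
          obtain ⟨q, hq, hzq⟩ := mem_iUnion₂.1 (hC.2.2 (show (z, w) ∈ Z ×ˢ W from ⟨hz, hw⟩))
          have hb := (bowenDist_prod_lt T R q.2 q.1 (z, w) hε).1 hzq
          exact mem_iUnion₂.2 ⟨(q.1.2, q.2), ⟨q, ⟨hq, hb.1⟩, rfl⟩, hb.2⟩
      have h1 : a ≤ ballSum R g t G := ha.trans (iInf₂_le G hG)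
      have h2 : ballSum R g t G ≤ ∑' i : C,
          (if bowenDist T i.1.2 i.1.1.1 z < ε then wt R g t (i.1.1.2, i.1.2) else 0) := by
        rw [ballSum_eq]
        have hch : ∀ r : G, ∃ i : C, bowenDist T i.1.2 i.1.1.1 z < ε ∧ (i.1.1.2, i.1.2) = r.1 := by
          rintro ⟨_, q, hq, rfl⟩
          exact ⟨⟨q, hq.1⟩, hq.2, rfl⟩
        choose φ hφ hφ' using hch
        have hinj : Function.Injective φ := fun r r' h => Subtype.ext (by
          rw [← hφ' r, ← hφ' r', h])
        refine le_trans (le_of_eq ?_) (ENNReal.tsum_comp_le_tsum_of_injective hinj _)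
        refine tsum_congr fun r => ?_
        rw [if_pos (hφ r), hφ']
      calc (1 : ℝ≥0∞) = a⁻¹ * a := (ENNReal.inv_mul_cancel ha0 hat).symm
        _ ≤ a⁻¹ * ∑' i : C,
          (if bowenDist T i.1.2 i.1.1.1 z < ε then wt R g t (i.1.1.2, i.1.2) else 0) := by
            gcongr
            exact h1.trans h2
        _ = _ := by
            rw [← ENNReal.tsum_mul_left]
            refine tsum_congr fun i => ?_
            split_ifs <;> simp)
  calc _ ≤ a * ∑' i : C, a⁻¹ * wt R g t (i.1.1.2, i.1.2) * wt T f s (i.1.1.1, i.1.2) := by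
        gcongr
    _ = ∑' i : C, wt (X := fun k => X k × Y k) (pm T R) (pf f g) (s + t) i.1 := by
        rw [← ENNReal.tsum_mul_left]
        refine tsum_congr fun i => ?_
        rw [mul_assoc, ← mul_assoc a, ENNReal.mul_inv_cancel ha0 hat, one_mul, mul_comm,
          ← wt_prod]

lemma exists_tail (δ : ℝ) (hδ : 0 < δ) : ∃ N₀ : ℕ, ∀ N ≥ N₀,
    (∑' n : ℕ, if N ≤ n then ENNReal.ofReal (Real.exp (-(n * δ))) else 0) < 1 := by
  have hs : Summable fun n : ℕ => Real.exp (-(n * δ)) := by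
    have := Real.summable_exp_nat_mul_iff.2 (neg_lt_zero.2 hδ)
    simpa using this
  have hfin : ∑' n : ℕ, ENNReal.ofReal (Real.exp (-(n * δ))) ≠ ⊤ := hs.tsum_ofReal_ne_top
  have ht := ENNReal.tendsto_sum_nat_add (fun n : ℕ => ENNReal.ofReal (Real.exp (-(n * δ)))) hfin
  obtain ⟨N₀, hN₀⟩ := eventually_atTop.1 (ht.eventually (gt_mem_nhds one_pos))
  refine ⟨N₀, fun N hN => lt_of_le_of_lt (le_of_eq ?_) (hN₀ N hN)⟩
  rw [← (ENNReal.summable).sum_add_tsum_nat_add' (k := N)]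
  rw [Finset.sum_eq_zero, zero_add]
  · refine tsum_congr fun n => ?_
    rw [if_pos (Nat.le_add_left _ _)]
  · intro i hi
    rw [if_neg]
    exact not_le.2 (Finset.mem_range.1 hi)

lemma exists_var (T : ∀ k, X k → X (k + 1)) (f : ∀ k, X k → ℝ) (hfe : EquicontPotential f)
    (δ : ℝ) (hδ : 0 < δ) : ∃ ε₀ > 0, ∀ ε, 0 < ε → ε ≤ ε₀ →
    ∀ n x y, bowenDist T n x y < ε → birk T f n y ≤ birk T f n x + n * δ := by
  obtain ⟨ε₀, hε₀, h⟩ := hfe δ hδ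
  refine ⟨ε₀, hε₀, fun ε hε hle n x y hxy => ?_⟩
  have hd := (bowenDist_lt_iff T n x y hε).1 hxy
  calc birk T f n y ≤ ∑ j ∈ Finset.range n, (f j (iter T j x) + δ) := by
        refine Finset.sum_le_sum fun j hj => ?_
        have := (abs_lt.1 (h j _ _ ((hd j (Finset.mem_range.1 hj)).trans_le hle))).1
        linarith
    _ = _ := by simp [birk, Finset.sum_add_distrib]

lemma exists_of_lt_PB (T : ∀ k, X k → X (k + 1)) (f : ∀ k, X k → ℝ) (Z : Set (X 0)) (s : ℝ)
    (h : (s : EReal) < PB T f Z) :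
    ∃ ε₀ > 0, ∀ ε ≤ ε₀, bowenMeas T f Z s ε ≠ 0 := by
  unfold PB at h
  simp only [lt_iSup_iff, exists_prop] at h
  obtain ⟨ε₀, hε₀, h⟩ := h
  refine ⟨ε₀, hε₀, fun ε hε h0 => ne_zero_of_lt_crit h ?_⟩
  have := bowenMeas_mono T f Z (le_refl s) hε
  rw [h0] at this
  simpa using this

lemma exists_N (T : ∀ k, X k → X (k + 1)) (f : ∀ k, X k → ℝ) (Z : Set (X 0)) (s ε : ℝ)
    (h : bowenMeas T f Z s ε ≠ 0) : ∃ N₀, ∀ N ≥ N₀, bowenPreMeas T f Z s N ε ≠ 0 := by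
  unfold bowenMeas at h
  simp only [ne_eq, ENNReal.iSup_eq_zero, not_forall] at h
  obtain ⟨N₀, h⟩ := h
  refine ⟨N₀, fun N hN h0 => h ?_⟩
  have := bowenPreMeas_mono T f Z (le_refl s) hN (le_refl ε)
  rw [h0] at this
  simpa using this

lemma lower_bound (T : ∀ k, X k → X (k + 1)) (R : ∀ k, Y k → Y (k + 1))
    (f : ∀ k, X k → ℝ) (hfe : EquicontPotential f) (g : ∀ k, Y k → ℝ)
    (Z : Set (X 0)) (W : Set (Y 0))
    (s s' t : ℝ) (hss : s < s') (hs : (s' : EReal) < PB T f Z) (ht : (t : EReal) < PB R g W) :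
    ((s + t : ℝ) : EReal) ≤ PB (X := fun k => X k × Y k) (pm T R) (pf f g) (Z ×ˢ W) := by
  obtain ⟨δ, hδ, rfl⟩ : ∃ δ > 0, s' = s + 2 * δ := ⟨(s' - s) / 2, by linarith, by ring⟩
  obtain ⟨ε₁, hε₁, h1⟩ := exists_of_lt_PB T f Z _ hs
  obtain ⟨ε₂, hε₂, h2⟩ := exists_of_lt_PB R g W _ ht
  obtain ⟨ε₃, hε₃, h3⟩ := exists_var T f hfe δ hδ
  obtain ⟨ε, hε, hεε₁, hεε₂, hεε₃⟩ : ∃ ε > 0, 2 * ε ≤ ε₁ ∧ ε ≤ ε₂ ∧ ε ≤ ε₃ := by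
    refine ⟨min (ε₁ / 2) (min ε₂ ε₃), by positivity, ?_, ?_, ?_⟩
    · have := min_le_left (ε₁ / 2) (min ε₂ ε₃)
      linarith
    · exact (min_le_right _ _).trans (min_le_left _ _)
    · exact (min_le_right _ _).trans (min_le_right _ _)
  obtain ⟨N₁, hN₁⟩ := exists_N T f Z _ _ (h1 _ hεε₁)
  obtain ⟨N₂, hN₂⟩ := exists_N R g W _ _ (h2 _ hεε₂)
  obtain ⟨N₃, hN₃⟩ := exists_tail δ hδ
  let N := max N₁ (max N₂ N₃)
  have hM1 := hN₁ N (le_max_left _ _)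
  have hM2 := hN₂ N ((le_max_left _ _).trans (le_max_right _ _))
  have hM3 := hN₃ N ((le_max_right _ _).trans (le_max_right _ _))
  have key := le_bowenPreMeas_prod T R f g Z W s t δ ε hε N (h3 ε hε hεε₃) hM3
    (min 1 (bowenPreMeas R g W t N ε)) (by simp [min_eq_iff, hM2]) (by simp) (min_le_right _ _)
  refine le_trans ?_ (le_iSup₂ (f := fun ε (_ : 0 < ε) =>
    PBe (X := fun k => X k × Y k) (pm T R) (pf f g) (Z ×ˢ W) ε) ε hε)
  refine le_crit (M := fun s => bowenMeas (X := fun k => X k × Y k) (pm T R) (pf f g) (Z ×ˢ W) s ε)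
    (fun a b h => bowenMeas_mono _ _ _ h le_rfl) fun h0 => ?_
  have h4 := key.trans (le_iSup (fun N => bowenPreMeas (X := fun k => X k × Y k) (pm T R) (pf f g)
    (Z ×ˢ W) (s + t) N ε) N)
  rw [show (⨆ N, bowenPreMeas (X := fun k => X k × Y k) (pm T R) (pf f g)
    (Z ×ˢ W) (s + t) N ε) = 0 from h0, nonpos_iff_eq_zero, mul_eq_zero] at h4
  rcases h4 with h4 | h4
  · simp [min_eq_iff, hM2] at h4
  · exact hM1 h4

end helpers

end NDS

/-- **product rule for the Bowen pressure.** For equicontinuous potentials,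
`P^B(T,f,Z) + P^B(R,g,W) ≤ P^B(T×R, f∔g, Z×W) ≤ P^B(T,f,Z) + P^P(R,g,W)`, provided the sums
are not of the form `(+∞)+(−∞)`. -/
theorem bowen_pressure_product_rule {X Y : ℕ → Type*} [∀ k, MetricSpace (X k)]
    [∀ k, CompactSpace (X k)] [∀ k, MetricSpace (Y k)] [∀ k, CompactSpace (Y k)]
    (T : ∀ k, X k → X (k + 1)) (hT : ∀ k, Continuous (T k))
    (R : ∀ k, Y k → Y (k + 1)) (hR : ∀ k, Continuous (R k))
    (f : ∀ k, X k → ℝ) (hf : ∀ k, Continuous (f k)) (hfe : NDS.EquicontPotential f)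
    (g : ∀ k, Y k → ℝ) (hg : ∀ k, Continuous (g k)) (hge : NDS.EquicontPotential g)
    (Z : Set (X 0)) (W : Set (Y 0))
    (h₁ : NDS.AddCompat (NDS.PB T f Z) (NDS.PB R g W))
    (h₂ : NDS.AddCompat (NDS.PB T f Z) (NDS.PP R g W)) :
    NDS.PB T f Z + NDS.PB R g W ≤
      NDS.PB (X := fun k => X k × Y k) (fun k p => (T k p.1, R k p.2))
        (fun k p => f k p.1 + g k p.2) (Z ×ˢ W) ∧
    NDS.PB (X := fun k => X k × Y k) (fun k p => (T k p.1, R k p.2))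
        (fun k p => f k p.1 + g k p.2) (Z ×ˢ W) ≤
      NDS.PB T f Z + NDS.PP R g W := by
  constructor
  · refine EReal.add_le_of_forall_lt fun a ha b hb => ?_
    obtain ⟨s, has, hs⟩ := EReal.lt_iff_exists_real_btwn.1 ha
    obtain ⟨s', hss, hs'⟩ := EReal.lt_iff_exists_real_btwn.1 hs
    obtain ⟨t, hbt, ht⟩ := EReal.lt_iff_exists_real_btwn.1 hb
    refine (add_le_add has.le hbt.le).trans ?_
    rw [← EReal.coe_add]
    exact NDS.lower_bound T R f hfe g Z W s s' t (EReal.coe_lt_coe_iff.1 hss) hs' ht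
  · refine EReal.le_add_of_forall_gt ?_ ?_ fun a ha b hb => ?_
    · exact not_and_or.1 h₂.2
    · exact not_and_or.1 h₂.1
    obtain ⟨s, hs, hsa⟩ := EReal.lt_iff_exists_real_btwn.1 ha
    obtain ⟨t, ht, htb⟩ := EReal.lt_iff_exists_real_btwn.1 hb
    refine le_trans ?_ (add_le_add hsa.le htb.le)
    rw [← EReal.coe_add]
    exact NDS.upper_bound T R f g Z W s t hs ht
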